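/- Fix λ > 0 and suppose 0 < τ_min < T and C_d > 0, and let E(τ) = e^{−λ τ}((C_d λ − 1) e^{λ τ} + λ τ + 1). Then the defender's best response to λ is characterized as follows: (i) if E(τ) > 0 for all τ ∈ [τ_min, T], then T is the unique maximizer of τ ↦ u_d(τ, λ) over [τ_min, T]; (ii) if E(τ) < 0 for all τ ∈ [τ_min, T], then τ_min is the unique maximizer; (iii) if 1 − λ C_d < (1 + λ τ + λ² τ²/2) e^{−λ τ} for all τ ∈ [τ_min, T] and τ* ∈ [τ_min, T] satisfies E(τ*) = 0, then τ* is the unique maximizer. -/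

import Mathlib

open MeasureTheory Set Real

/-- Attacker payoff in the specific instantiation `G(τ_d,τ_a) = τ_d − τ_a`,
`f(τ_a; λ) = λ e^{−λ τ_a}`: `u_a(τ_d, λ) = τ_d − ∫₀^{τ_d} e^{−λ s} ds − λ C_a`. -/
noncomputable def uaExp (Ca τd l : ℝ) : ℝ :=
  τd - (∫ s in (0:ℝ)..τd, Real.exp (-l * s)) - l * Ca

/-- Defender payoff in the specific instantiation:
`u_d(τ_d, λ) = −(τ_d − ∫₀^{τ_d} e^{−λ s} ds + C_d)/τ_d`. -/
noncomputable def udExp (Cd τd l : ℝ) : ℝ :=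
  -(τd - (∫ s in (0:ℝ)..τd, Real.exp (-l * s)) + Cd) / τd

theorem integral_exp_neg_mul {l : ℝ} (hl : l ≠ 0) (t : ℝ) :
    ∫ s in (0:ℝ)..t, Real.exp (-l * s) = (1 - Real.exp (-l * t)) / l := by
  rw [intervalIntegral.integral_comp_mul_left (fun x => Real.exp x) (neg_ne_zero.mpr hl),
    integral_exp, smul_eq_mul, mul_zero, Real.exp_zero]
  field_simp
  ring

/-- The payoff at `t` is strictly below the payoff at `s` whenever the derivative of the payoff
at `s` does not point from `s` towards `t`. -/
theorem udExp_lt_of_mul_nonneg {l Cd s t : ℝ} (hl : 0 < l) (hs : 0 < s) (ht : 0 < t)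
    (hts : t ≠ s)
    (h : 0 ≤ (s - t) * (Real.exp (-l * s) *
      ((Cd * l - 1) * Real.exp (l * s) + l * s + 1))) :
    udExp Cd t l < udExp Cd s l := by
  have hinv : Real.exp (-l * s) * Real.exp (l * s) = 1 := by
    rw [← Real.exp_add, neg_mul, neg_add_cancel, Real.exp_zero]
  have hslope : Real.exp (-l * s) * (1 - l * (t - s)) < Real.exp (-l * t) := by
    have hne : -l * (t - s) ≠ 0 := mul_ne_zero (neg_ne_zero.mpr hl.ne') (sub_ne_zero.mpr hts)
    have hsplit : Real.exp (-l * t) = Real.exp (-l * s) * Real.exp (-l * (t - s)) := by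
      rw [← Real.exp_add]
      ring_nf
    rw [hsplit]
    exact mul_lt_mul_of_pos_left (by linarith [Real.add_one_lt_exp hne]) (Real.exp_pos _)
  have hE : Real.exp (-l * s) * ((Cd * l - 1) * Real.exp (l * s) + l * s + 1) =
      (Cd * l - 1) + (l * s + 1) * Real.exp (-l * s) := by
    linear_combination (Cd * l - 1) * hinv
  rw [hE] at h
  have hmul := mul_lt_mul_of_pos_left hslope hs
  unfold udExp
  rw [integral_exp_neg_mul hl.ne', integral_exp_neg_mul hl.ne', div_lt_div_iff₀ ht hs,
    ← mul_lt_mul_iff_right₀ hl]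
  generalize Real.exp (-l * s) = a at *
  generalize Real.exp (-l * t) = b at *
  field_simp
  nlinarith

/-- Lemma (defender's best response, specific instantiation): with
`E(τ) = e^{−λ τ}((C_d λ − 1) e^{λ τ} + λ τ + 1)`, the unique maximizer of
`τ ↦ u_d(τ, λ)` on `[τ_min, T]` is `T` if `E > 0` everywhere, `τ_min` if `E < 0`
everywhere, and (under the concavity condition) any zero of `E` in `[τ_min, T]`. -/
theorem defender_best_response_specific
    (τmin T l Cd : ℝ)
    (hl : 0 < l) (hτmin : 0 < τmin) (hτT : τmin < T) (hCd : 0 < Cd)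
    (E : ℝ → ℝ)
    (hE : E = fun τ => Real.exp (-l * τ) *
      ((Cd * l - 1) * Real.exp (l * τ) + l * τ + 1)) :
    ((∀ τ ∈ Icc τmin T, 0 < E τ) →
      ∀ τ ∈ Icc τmin T, τ ≠ T → udExp Cd τ l < udExp Cd T l) ∧
    ((∀ τ ∈ Icc τmin T, E τ < 0) →
      ∀ τ ∈ Icc τmin T, τ ≠ τmin → udExp Cd τ l < udExp Cd τmin l) ∧
    ((∀ τ ∈ Icc τmin T,
        1 - l * Cd < (1 + l * τ + l ^ 2 * τ ^ 2 / 2) * Real.exp (-l * τ)) →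
      ∀ τstar ∈ Icc τmin T, E τstar = 0 →
        ∀ τ ∈ Icc τmin T, τ ≠ τstar → udExp Cd τ l < udExp Cd τstar l) := by
  subst hE
  refine ⟨fun h t ht hne => ?_, fun h t ht hne => ?_, fun _ s hs h t ht hne => ?_⟩
  · exact udExp_lt_of_mul_nonneg hl (hτmin.trans hτT) (hτmin.trans_le ht.1) hne
      (mul_nonneg (sub_nonneg.mpr ht.2) (h T (right_mem_Icc.mpr hτT.le)).le)
  · exact udExp_lt_of_mul_nonneg hl hτmin (hτmin.trans_le ht.1) hne
      (mul_nonneg_of_nonpos_of_nonpos (sub_nonpos.mpr ht.1)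
        (h τmin (left_mem_Icc.mpr hτT.le)).le)
  · exact udExp_lt_of_mul_nonneg hl (hτmin.trans_le hs.1) (hτmin.trans_le ht.1) hne
      (mul_eq_zero_of_right _ h).ge
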